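/- arXiv:1505.00667 — 3 statements merged into one kernel-verified Lean document; each statement's English description precedes it below -/
import Mathlib

section
/- For every n ≥ 3, |σ² − g_n/c_n| < 3/c_n², where g_n = c_n + 2e_n + f_n. -/
namespace Paper

/-- `s i = 2^{ν₂(i+1)}`, the largest power of 2 dividing `i+1`. -/
def s (i : ℕ) : ℕ := 2 ^ padicValNat 2 (i + 1)

/-- Continuant numerators, shifted by 2: `p 0 = p_{-2} = 0`, `p 1 = p_{-1} = 1`,
and `p (n+2) = p_n = s_n p_{n-1} + p_{n-2}`. -/
def p : ℕ → ℤ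
  | 0 => 0
  | 1 => 1
  | n + 2 => (s n : ℤ) * p (n + 1) + p n

/-- Continuant denominators, shifted by 2: `q 0 = q_{-2} = 1`, `q 1 = q_{-1} = 0`,
and `q (n+2) = q_n = s_n q_{n-1} + q_{n-2}`. -/
def q : ℕ → ℤ
  | 0 => 1
  | 1 => 0
  | n + 2 => (s n : ℤ) * q (n + 1) + q n

/-- Hurwitz–Kolden–Frame matrix of a finite sequence. -/
def M (l : List ℤ) : Matrix (Fin 2) (Fin 2) ℤ :=
  (l.map fun a => !![a, 1; 1, 0]).prod

/-- `u n = (s_1, s_2, ..., s_{2^n - 3})`. -/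
def u (n : ℕ) : List ℤ := (List.range (2 ^ n - 3)).map fun i => (s (i + 1) : ℤ)

/-- `v n = (s_1, s_2, ..., s_{2^n - 2})`. -/
def v (n : ℕ) : List ℤ := (List.range (2 ^ n - 2)).map fun i => (s (i + 1) : ℤ)

def c (n : ℕ) : ℤ := M (u n) 0 0
def e (n : ℕ) : ℤ := M (u n) 0 1
def d (n : ℕ) : ℤ := M (u n) 1 0
def f (n : ℕ) : ℤ := M (u n) 1 1
def w (n : ℕ) : ℤ := M (v n) 0 0
def y (n : ℕ) : ℤ := M (v n) 0 1
def x (n : ℕ) : ℤ := M (v n) 1 0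
def z (n : ℕ) : ℤ := M (v n) 1 1
def g (n : ℕ) : ℤ := c n + 2 * e n + f n
def r (n : ℕ) : ℤ := 2 ^ n * (w n + x n) + w n + y n + z n

lemma padicValNat_two_pow_sub {n a : ℕ} (ha : 0 < a) (han : a < 2 ^ n) :
    padicValNat 2 (2 ^ n - a) = padicValNat 2 a := by
  have key : ∀ k, 2 ^ k ∣ 2 ^ n - a ↔ 2 ^ k ∣ a := by
    intro k
    rcases le_total k n with hk | hk
    · exact (Nat.dvd_sub_iff_right han.le (pow_dvd_pow 2 hk))
    · have hkn : 2 ^ n ≤ 2 ^ k := Nat.pow_le_pow_right (by norm_num) hk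
      constructor <;> intro h <;> have := Nat.le_of_dvd (by omega) h <;> omega
  have hne : 2 ^ n - a ≠ 0 := by omega
  apply le_antisymm
  · rw [← padicValNat_dvd_iff_le ha.ne', ← key]
    exact pow_padicValNat_dvd
  · rw [← padicValNat_dvd_iff_le hne, key]
    exact pow_padicValNat_dvd

lemma s_two_pow_sub_two {n : ℕ} (hn : 1 ≤ n) : s (2 ^ n - 2) = 1 := by
  have h2 : 2 ≤ 2 ^ n := Nat.pow_le_pow_right (n := 2) (by norm_num) hn
  have h : 2 ^ n - 2 + 1 = 2 ^ n - 1 := by omega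
  rw [s, h, padicValNat_two_pow_sub (by norm_num) (by omega)]
  simp

lemma M_reverse (l : List ℤ) : M l.reverse = (M l).transpose := by
  induction l with
  | nil => simp [M]
  | cons a l ih =>
    have hM : M (a :: l) = !![a, 1; 1, 0] * M l := by simp [M]
    have hT : (!![a, 1; 1, 0] : Matrix (Fin 2) (Fin 2) ℤ).transpose = !![a, 1; 1, 0] := by
      ext i j; fin_cases i <;> fin_cases j <;> rfl
    rw [hM, Matrix.transpose_mul, ← ih, hT]
    simp [M]

lemma u_reverse (n : ℕ) : (u n).reverse = u n := by
  apply List.ext_getElem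
  · simp
  · intro i h₁ h₂
    have hi : i < 2 ^ n - 3 := by simpa [u] using h₂
    have h : 2 ^ n - 3 - 1 - i + 1 + 1 = 2 ^ n - (i + 1 + 1) := by omega
    simp only [u, List.getElem_reverse, List.getElem_map, List.getElem_range, List.length_map,
      List.length_range, s]
    rw [h, padicValNat_two_pow_sub (by omega) (by omega)]

lemma d_eq_e (n : ℕ) : d n = e n := by
  have h := M_reverse (u n)
  rw [u_reverse] at h
  exact congrFun (congrFun h 1) 0

/-- The matrix of the tail `(s_1, …, s_j)` in terms of convergents of `(s_0, …, s_j)`. -/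
lemma M_tail (j : ℕ) :
    M ((List.range j).map fun i => (s (i + 1) : ℤ)) =
      !![q (j + 2), q (j + 1); p (j + 2) - q (j + 2), p (j + 1) - q (j + 1)] := by
  induction j with
  | zero => ext i j; fin_cases i <;> fin_cases j <;> simp [M, p, q, s]
  | succ j ih =>
    have hM : M ((List.range (j + 1)).map fun i => (s (i + 1) : ℤ)) =
        M ((List.range j).map fun i => (s (i + 1) : ℤ)) * !![(s (j + 1) : ℤ), 1; 1, 0] := by
      simp [M, List.range_succ]
    have hp : p (j + 1 + 2) = s (j + 1) * p (j + 2) + p (j + 1) := rfl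
    have hq : q (j + 1 + 2) = s (j + 1) * q (j + 2) + q (j + 1) := rfl
    rw [hM, ih, hp, hq, Matrix.mul_fin_two]
    ext a b
    fin_cases a <;> fin_cases b <;> simp <;> ring

lemma p_mul_q_sub (m : ℕ) : p (m + 1) * q m - p m * q (m + 1) = (-1) ^ m := by
  induction m with
  | zero => simp [p, q]
  | succ m ih =>
    rw [pow_succ, ← ih]
    simp only [p, q]
    ring

lemma q_nonneg_pos (m : ℕ) : 0 ≤ q (m + 1) ∧ 0 < q (m + 2) := by
  induction m with
  | zero => simp [q]
  | succ m ih =>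
    have hs : 0 < (s (m + 1) : ℤ) := by simp [s]
    refine ⟨ih.2.le, ?_⟩
    change 0 < s (m + 1) * q (m + 2) + q (m + 1)
    have := mul_pos hs ih.2
    linarith [ih.1]

/-- Convergents after the `N`-th one all lie on the same side of it. -/
lemma cross_nonneg (N k : ℕ) :
    0 ≤ (-1) ^ N * (p (N + k) * q N - p N * q (N + k)) := by
  suffices h : 0 ≤ (-1) ^ N * (p (N + k) * q N - p N * q (N + k)) ∧
      0 ≤ (-1) ^ N * (p (N + k + 1) * q N - p N * q (N + k + 1)) from h.1
  induction k with
  | zero =>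
    refine ⟨by simp [mul_comm], ?_⟩
    rw [add_zero, p_mul_q_sub, ← mul_pow]
    simp
  | succ k ih =>
    refine ⟨ih.2, ?_⟩
    have hp : p (N + (k + 1) + 1) = s (N + k) * p (N + k + 1) + p (N + k) := rfl
    have hq : q (N + (k + 1) + 1) = s (N + k) * q (N + k + 1) + q (N + k) := rfl
    have hs : 0 ≤ (s (N + k) : ℤ) := by positivity
    rw [hp, hq]
    nlinarith [mul_nonneg hs ih.2, ih.1]

lemma limit_cross_nonneg {σ : ℝ}
    (hσ : Filter.Tendsto (fun n : ℕ => (p (n + 2) : ℝ) / (q (n + 2) : ℝ)) Filter.atTop (nhds σ))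
    (N : ℕ) : 0 ≤ (-1) ^ N * (σ * q N - p N) := by
  have hlim := ((hσ.mul_const (q N : ℝ)).sub_const (p N : ℝ)).const_mul ((-1 : ℝ) ^ N)
  refine ge_of_tendsto hlim ?_
  filter_upwards [Filter.eventually_ge_atTop N] with m hm
  obtain ⟨k, hk⟩ := Nat.exists_eq_add_of_le (show N ≤ m + 2 by omega)
  have hq : (0 : ℝ) < q (m + 2) := by exact_mod_cast (q_nonneg_pos m).2
  have h : (0 : ℝ) ≤ (-1) ^ N * (p (m + 2) * q N - p N * q (m + 2)) := by
    rw [hk]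
    exact_mod_cast cross_nonneg N k
  have heq : (-1 : ℝ) ^ N * (p (m + 2) / q (m + 2) * q N - p N) =
      (-1) ^ N * (p (m + 2) * q N - p N * q (m + 2)) / q (m + 2) := by
    field_simp
  rw [heq]
  positivity

end Paper

open Paper Filter Real

/-- For n ≥ 3, `|σ² − g_n/c_n| < 3/c_n²`. -/
theorem sigma_sq_approx (σ : ℝ)
    (hσ : Tendsto (fun n : ℕ => (p (n + 2) : ℝ) / (q (n + 2) : ℝ)) atTop (nhds σ))
    (n : ℕ) (hn : 3 ≤ n) :
    |σ ^ 2 - (g n : ℝ) / (c n : ℝ)| < 3 / (c n : ℝ) ^ 2 := by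
  have hpow : 8 ≤ 2 ^ n := Nat.pow_le_pow_right (n := 2) (by norm_num) hn
  have heven : Even (2 ^ n) := (Nat.even_pow' (by omega)).2 even_two
  obtain ⟨j, hj⟩ : ∃ j, 2 ^ n = j + 3 := ⟨2 ^ n - 3, by omega⟩
  have hodd : Odd (j + 2) := by
    rw [hj] at heven
    grind
  have hu := M_tail j
  rw [show j = 2 ^ n - 3 by omega, ← u, show 2 ^ n - 3 = j by omega] at hu
  have hc : c n = q (j + 2) := by simp [c, hu]
  have he : e n = q (j + 1) := by simp [e, hu]
  have hd : d n = p (j + 2) - q (j + 2) := by simp [d, hu]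
  have hf : f n = p (j + 1) - q (j + 1) := by simp [f, hu]
  have hs : s (j + 1) = 1 := by
    rw [show j + 1 = 2 ^ n - 2 by omega]
    exact s_two_pow_sub_two (by omega)
  have hp3 : p (j + 2 + 1) = p (j + 2) + p (j + 1) := by
    change s (j + 1) * p (j + 2) + p (j + 1) = _
    simp [hs]
  have hq3 : q (j + 2 + 1) = q (j + 2) + q (j + 1) := by
    change s (j + 1) * q (j + 2) + q (j + 1) = _
    simp [hs]
  have hde := d_eq_e n
  have hp2 : p (j + 2) = c n + e n := by linarith
  have hp1 : p (j + 1) = e n + f n := by linarith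
  have hdet : (c n + e n) ^ 2 = g n * c n + 1 := by
    have h := p_mul_q_sub (j + 1)
    rw [hp2, hp1, ← hc, ← he, (show Even (j + 1) by grind).neg_one_pow] at h
    rw [g]
    linarith
  have hcpos : 0 < c n := hc ▸ (q_nonneg_pos j).2
  have hepos : 0 ≤ e n := he ▸ (q_nonneg_pos j).1
  have hgnonneg : 0 ≤ g n := by
    have : 0 < g n * c n + c n := by nlinarith
    nlinarith
  have hupper := limit_cross_nonneg hσ (j + 2)
  have hlower := limit_cross_nonneg hσ (j + 2 + 1)
  rw [hodd.neg_one_pow, hp2, ← hc] at hupper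
  rw [hodd.add_one.neg_one_pow, hp3, hq3, hp2, hp1, ← hc, ← he,
    show c n + e n + (e n + f n) = g n by rw [g]; ring] at hlower
  have hdet' : ((c n : ℝ) + e n) ^ 2 = g n * c n + 1 := by exact_mod_cast hdet
  have hC : (0 : ℝ) < c n := by exact_mod_cast hcpos
  have hE : (0 : ℝ) ≤ e n := by exact_mod_cast hepos
  have hG : (0 : ℝ) ≤ g n := by exact_mod_cast hgnonneg
  push_cast at hupper hlower
  generalize (c n : ℝ) = C at *
  generalize (e n : ℝ) = E at *
  generalize (g n : ℝ) = G at *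
  have hσ0 : 0 ≤ σ := by
    by_contra! hneg
    nlinarith
  have hsq_upper : (σ * C) ^ 2 ≤ G * C + 1 := by
    rw [← hdet']
    exact pow_le_pow_left₀ (by positivity) (by linarith) 2
  have hsq_lower : G ^ 2 ≤ σ ^ 2 * (G * C + 1) := by
    rw [← hdet', ← mul_pow]
    exact pow_le_pow_left₀ hG (by linarith) 2
  have hGC : 0 ≤ G * C := by positivity
  have hlow : G * C - 1 ≤ (σ * C) ^ 2 := by
    have h : (G * C - 1) * (G * C + 1) ≤ (σ * C) ^ 2 * (G * C + 1) := by
      nlinarith [mul_le_mul_of_nonneg_right hsq_lower (sq_nonneg C)]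
    exact le_of_mul_le_mul_right h (by linarith)
  have heq : σ ^ 2 - G / C = ((σ * C) ^ 2 - G * C) / C ^ 2 := by
    field_simp
  rw [heq, abs_div, abs_of_pos (show 0 < C ^ 2 by positivity)]
  refine div_lt_div_of_pos_right ?_ (by positivity)
  rw [abs_lt]
  constructor <;> linarith
end

section
/- For every n ≥ 3, |σ − √(g_n/c_n)| < 1/c_n², where g_n = c_n + 2e_n + f_n. -/
namespace Paper

lemma s_pos (i : ℕ) : 0 < s i := by
  unfold s; positivity

/-- The ruler sequence is symmetric on `0, …, 2 ^ n - 2`. -/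
lemma s_symm {n i j : ℕ} (h : i + j + 2 = 2 ^ n) : s i = s j := by
  obtain ⟨k, m, hm, hi⟩ := Nat.exists_eq_two_pow_mul_odd (n := i + 1) (by omega)
  have hkn : k < n := by
    by_contra hk
    have h1 : 2 ^ n ≤ 2 ^ k := Nat.pow_le_pow_right (by norm_num) (not_lt.mp hk)
    have h2 : 2 ^ k ≤ 2 ^ k * m := Nat.le_mul_of_pos_right _ hm.pos
    omega
  obtain ⟨t, rfl⟩ := Nat.exists_eq_add_of_lt hkn
  have hpow : 2 ^ (k + t + 1) = 2 ^ k * (2 * 2 ^ t) := by ring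
  have hlt : m < 2 * 2 ^ t := by
    refine lt_of_mul_lt_mul_left (a := 2 ^ k) ?_ (Nat.zero_le _)
    omega
  obtain ⟨m', hm'⟩ := Nat.exists_eq_add_of_lt hlt
  have hj : j + 1 = 2 ^ k * (m' + 1) := by
    have : 2 ^ k * (2 * 2 ^ t) = 2 ^ k * m + 2 ^ k * (m' + 1) := by rw [hm']; ring
    omega
  have hodd : ¬ 2 ∣ m' + 1 := by
    obtain ⟨a, ha⟩ := hm
    omega
  have hval : ∀ a, ¬ 2 ∣ a → padicValNat 2 (2 ^ k * a) = k := by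
    intro a ha
    have ha0 : a ≠ 0 := by rintro rfl; simp at ha
    rw [padicValNat.mul (by positivity) ha0, padicValNat.prime_pow,
      padicValNat.eq_zero_of_not_dvd ha, add_zero]
  unfold s
  rw [hi, hj, hval m hm.not_two_dvd_nat, hval _ hodd]

lemma M_append (l l' : List ℤ) : M (l ++ l') = M l * M l' := by
  simp [M]

lemma M_cons (a : ℤ) (l : List ℤ) : M (a :: l) = !![a, 1; 1, 0] * M l := by
  simp [M]

lemma M_singleton (a : ℤ) : M [a] = !![a, 1; 1, 0] := by
  simp [M]

lemma abs_det_M (l : List ℤ) : |(M l).det| = 1 := by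
  induction l with
  | nil => simp [M]
  | cons a l ih => rw [M_cons, Matrix.det_mul, abs_mul, ih]; simp [Matrix.det_fin_two]

lemma abs_det_u (n : ℕ) : |c n * f n - e n * d n| = 1 := by
  simpa [Matrix.det_fin_two, c, d, e, f] using abs_det_M (u n)

lemma M_prefix (k : ℕ) :
    M ((List.range k).map fun i => (s i : ℤ)) = !![p (k + 1), p k; q (k + 1), q k] := by
  induction k with
  | zero => simp [M, p, q, Matrix.one_fin_two]
  | succ k ih =>
    rw [List.range_succ, List.map_append, M_append, ih, List.map_singleton, M_singleton,
      Matrix.mul_fin_two, p, q]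
    ext i j
    fin_cases i <;> fin_cases j <;> simp [mul_comm]

lemma convergents_eq {n N : ℕ} (hN : N + 2 = 2 ^ n) (hN0 : 0 < N) :
    p (N + 1) = c n + d n ∧ p N = e n + f n ∧ q (N + 1) = c n ∧ q N = e n := by
  have hs : (s 0 : ℤ) = 1 := by simp [s]
  have hl : ((List.range N).map fun i => (s i : ℤ)) = 1 :: u n := by
    obtain ⟨k, rfl⟩ := Nat.exists_eq_succ_of_ne_zero hN0.ne'
    rw [List.range_succ_eq_map, u, show 2 ^ n - 3 = k by omega]
    simp [hs, Function.comp_def]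
  have h := M_prefix N
  rw [hl, M_cons] at h
  refine ⟨?_, ?_, ?_, ?_⟩
  · simpa [Matrix.mul_apply, c, d, e, f] using (congrFun (congrFun h 0) 0).symm
  · simpa [Matrix.mul_apply, c, d, e, f] using (congrFun (congrFun h 0) 1).symm
  · simpa [Matrix.mul_apply, c, d, e, f] using (congrFun (congrFun h 1) 0).symm
  · simpa [Matrix.mul_apply, c, d, e, f] using (congrFun (congrFun h 1) 1).symm

lemma q_bounds (k : ℕ) :
    (0 ≤ q (k + 1) ∧ q (k + 1) ≤ p (k + 1)) ∧ 0 < q (k + 2) ∧ q (k + 2) ≤ p (k + 2) := by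
  induction k with
  | zero => simp [p, q, s]
  | succ k ih =>
    obtain ⟨⟨h1, h2⟩, h3, h4⟩ := ih
    have hs : (0 : ℤ) < s (k + 1) := by exact_mod_cast s_pos _
    refine ⟨⟨h3.le, h4⟩, ?_, ?_⟩
    · rw [q]; positivity
    · rw [q, p]; gcongr

/-- Every later pair `(p, q)` is a nonnegative combination of two consecutive ones, the weight of
the newer one being at least that of the older one. -/
lemma exists_tail_weights (N k : ℕ) :
    ∃ a b : ℤ, 0 < a ∧ 0 ≤ b ∧ b ≤ a ∧
      p (N + 1 + k) = p (N + 1) * a + p N * b ∧ q (N + 1 + k) = q (N + 1) * a + q N * b := by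
  induction k using Nat.twoStepInduction with
  | zero => exact ⟨1, 0, by simp⟩
  | one =>
    have hs : (0 : ℤ) < s N := by exact_mod_cast s_pos _
    refine ⟨s N, 1, hs, zero_le_one, hs, ?_, ?_⟩
    · change p (N + 2) = _
      rw [p]; ring
    · change q (N + 2) = _
      rw [q]; ring
  | more k h0 h1 =>
    obtain ⟨a, b, ha, hb, hba, hp, hq⟩ := h0
    obtain ⟨a', b', ha', hb', hba', hp', hq'⟩ := h1
    have hs : (0 : ℤ) < s (N + 1 + k) := by exact_mod_cast s_pos _
    refine ⟨s (N + 1 + k) * a' + a, s (N + 1 + k) * b' + b, by positivity, by positivity,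
      by gcongr, ?_, ?_⟩
    · change p (N + 1 + k + 2) = _
      rw [p, hp, show N + 1 + k + 1 = N + 1 + (k + 1) by ring, hp']; ring
    · change q (N + 1 + k + 2) = _
      rw [q, hq, show N + 1 + k + 1 = N + 1 + (k + 1) by ring, hq']; ring

/-- The two continued fractions `[1; u, a / b]` and `[1; u, X + 1] = X`, where the matrix of `u` is
`!![c, e; e, f]`, differ by at most `(1 - 1 / (X + 1)) / c ^ 2`. -/
lemma abs_sub_sqrt_le {c e f a b X : ℝ} (hc : 0 < c) (he : 0 ≤ e) (hdet : |c * f - e * e| = 1)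
    (hX : 1 ≤ X) (hcX : c * X ^ 2 = c + 2 * e + f) (ha : 0 < a) (hb : 0 ≤ b) (hba : b ≤ a) :
    |((c + e) * a + (e + f) * b) / (c * a + e * b) - X| ≤ (1 - 1 / (X + 1)) / c ^ 2 := by
  have hD : 0 < c * a + e * b := by positivity
  have hE : 0 < c * (X + 1) + e := by positivity
  have key : ((c + e) * a + (e + f) * b) / (c * a + e * b) - X =
      (c * f - e * e) * (b * (X + 1) - a) / ((c * a + e * b) * (c * (X + 1) + e)) := by
    rw [div_sub' hD.ne', div_eq_div_iff hD.ne' (by positivity)]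
    have hf : f = c * X ^ 2 - c - 2 * e := by linarith
    subst hf
    ring
  have hnum : |b * (X + 1) - a| ≤ a * X := by
    rw [abs_le]; constructor <;> nlinarith
  rw [key, abs_div, abs_mul, hdet, one_mul, abs_of_pos (mul_pos hD hE)]
  calc |b * (X + 1) - a| / ((c * a + e * b) * (c * (X + 1) + e))
      ≤ a * X / ((c * a) * (c * (X + 1))) := by
        gcongr
        · exact le_add_of_nonneg_right (by positivity)
        · exact le_add_of_nonneg_right he
    _ = (1 - 1 / (X + 1)) / c ^ 2 := by
        have : X + 1 ≠ 0 := by positivity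
        field_simp
        ring

end Paper

open Paper Filter Real

/-- For n ≥ 3, `|σ − √(g_n/c_n)| < 1/c_n²`. -/
theorem sigma_approx (σ : ℝ)
    (hσ : Tendsto (fun n : ℕ => (p (n + 2) : ℝ) / (q (n + 2) : ℝ)) atTop (nhds σ))
    (n : ℕ) (hn : 3 ≤ n) :
    |σ - Real.sqrt ((g n : ℝ) / (c n : ℝ))| < 1 / (c n : ℝ) ^ 2 := by
  have h8 : 2 ^ 3 ≤ 2 ^ n := Nat.pow_le_pow_right (by norm_num) hn
  obtain ⟨N, hN⟩ : ∃ N, N + 1 + 2 = 2 ^ n := ⟨2 ^ n - 3, by omega⟩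
  obtain ⟨hp₁, hp₀, hq₁, hq₀⟩ := convergents_eq hN N.succ_pos
  obtain ⟨⟨he, hf⟩, hc, -⟩ := q_bounds N
  rw [hq₀] at he
  rw [hq₀, hp₀] at hf
  rw [show N + 2 = N + 1 + 1 from rfl, hq₁] at hc
  rw [d_eq_e] at hp₁
  have hcR : (0 : ℝ) < c n := by exact_mod_cast hc
  have heR : (0 : ℝ) ≤ e n := by exact_mod_cast he
  have hfR : (0 : ℝ) ≤ f n := by exact_mod_cast (by linarith : 0 ≤ f n)
  have hdet : |(c n : ℝ) * f n - e n * e n| = 1 := by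
    have h := abs_det_u n
    rw [d_eq_e] at h
    exact_mod_cast h
  have hg : (g n : ℝ) = c n + 2 * e n + f n := by simp [g]
  set X := Real.sqrt ((g n : ℝ) / (c n : ℝ))
  have hX : 1 ≤ X := by
    refine Real.one_le_sqrt.mpr ?_
    rw [one_le_div hcR, hg]
    linarith
  have hcX : (c n : ℝ) * X ^ 2 = c n + 2 * e n + f n := by
    rw [Real.sq_sqrt (by rw [hg]; positivity), ← hg]
    field_simp
  have hle : |σ - X| ≤ (1 - 1 / (X + 1)) / (c n : ℝ) ^ 2 := by
    refine le_of_tendsto (hσ.sub_const X).abs ?_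
    filter_upwards [eventually_ge_atTop N] with m hm
    obtain ⟨k, rfl⟩ := Nat.exists_eq_add_of_le hm
    obtain ⟨a, b, ha, hb, hba, hp, hq⟩ := exists_tail_weights (N + 1) k
    rw [show N + k + 2 = N + 1 + 1 + k by ring, hp, hq, hp₁, hp₀, hq₁, hq₀]
    push_cast
    exact abs_sub_sqrt_le hcR heR hdet hX hcX (by exact_mod_cast ha) (by exact_mod_cast hb)
      (by exact_mod_cast hba)
  refine hle.trans_lt ?_
  gcongr
  exact sub_lt_self _ (by positivity)
end

section
/- For every n ≥ 2, 2^{n+1} w_{n+1} + 2 y_{n+1} = 2 (2^n w_n + y_n) r_n. -/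
open Paper Filter Real

theorem Paper.s_two_pow_sub_one (n : ℕ) : s (2 ^ n - 1) = 2 ^ n := by
  simp [s, Nat.sub_add_cancel Nat.one_le_two_pow]

/-- The sequence `s` repeats with shift `2 ^ n` on the first `2 ^ n - 1` indices. -/
theorem Paper.s_two_pow_add {n i : ℕ} (hi : i + 1 < 2 ^ n) : s (2 ^ n + i) = s i := by
  have hlt : padicValNat 2 (i + 1) < n := by
    rw [← Nat.pow_lt_pow_iff_right (a := 2) one_lt_two]
    exact (Nat.le_of_dvd i.succ_pos pow_padicValNat_dvd).trans_lt hi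
  have h : padicValNat 2 (2 ^ n + (i + 1)) = padicValNat 2 (i + 1) := by
    refine eq_of_forall_le_iff fun k => ?_
    rw [← padicValNat_dvd_iff_le (by positivity), ← padicValNat_dvd_iff_le i.succ_ne_zero]
    rcases le_or_gt k n with hk | hk
    · exact (Nat.dvd_add_iff_right (pow_dvd_pow 2 hk)).symm
    · have hn : ¬ 2 ^ n ∣ i + 1 := fun hd => (Nat.le_of_dvd i.succ_pos hd).not_gt hi
      have hnk : 2 ^ n ∣ 2 ^ k := pow_dvd_pow 2 hk.le
      exact iff_of_false
        (fun hd => hn ((Nat.dvd_add_iff_right dvd_rfl).mpr (hnk.trans hd)))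
        (fun hd => hn (hnk.trans hd))
  rw [s, s, add_assoc, h]

theorem Paper.v_succ {n : ℕ} (hn : 1 ≤ n) : v (n + 1) = v n ++ 2 ^ n :: 1 :: v n := by
  have h2 : 2 ≤ 2 ^ n := by simpa using Nat.pow_le_pow_right two_pos hn
  have hlen : 2 ^ (n + 1) - 2 = (2 ^ n - 2) + ((2 ^ n - 2) + 1 + 1) := by
    rw [pow_succ]; omega
  have hs : s (2 ^ n - 2 + 1) = 2 ^ n :=
    (congrArg s (by omega)).trans (s_two_pow_sub_one n)
  have hone : s (2 ^ n - 2 + 1 + 1) = 1 := by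
    have h0 : s 0 = 1 := by simp [s]
    exact (congrArg s (by omega)).trans ((s_two_pow_add (n := n) (by omega)).trans h0)
  rw [v, hlen, List.range_add, List.map_append, ← v, List.range_succ_eq_map,
    List.range_succ_eq_map]
  simp only [List.map_cons, List.map_map, add_zero, hs, Nat.cast_pow, Nat.cast_ofNat,
    Nat.succ_eq_add_one, zero_add, hone, Nat.cast_one]
  congr 3
  rw [v]
  refine List.map_congr_left fun i hi => ?_
  rw [List.mem_range] at hi
  simp only [Function.comp_apply, Nat.cast_inj]
  rw [← s_two_pow_add (n := n) (i := i + 1) (by omega)]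
  congr 1
  omega

theorem Paper.M_v_succ {n : ℕ} (hn : 1 ≤ n) :
    M (v (n + 1)) = M (v n) * (!![2 ^ n, 1; 1, 0] * (!![1, 1; 1, 0] * M (v n))) := by
  simp [v_succ hn, M]

/-- For n ≥ 2, `2^{n+1} w_{n+1} + 2 y_{n+1} = 2 (2^n w_n + y_n) r_n`. -/
theorem w_y_succ_eq (n : ℕ) (hn : 2 ≤ n) :
    2 ^ (n + 1) * w (n + 1) + 2 * y (n + 1) = 2 * (2 ^ n * w n + y n) * r n := by
  rw [r, w, y, M_v_succ (one_le_two.trans hn)]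
  simp only [Matrix.mul_apply, Fin.sum_univ_two, Matrix.of_apply, Matrix.cons_val',
    Matrix.cons_val_zero, Matrix.cons_val_one, Matrix.cons_val_fin_one, w, x, y, z]
  ring
end
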